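/- Assuming the Weil bound |S(m,n;q)| ≤ τ(q)√((m,n,q)q), the variance Var(μ_q; B_R) satisfies Var(μ_q; B_R) ≤ C_ε · (vol(B_R)/φ(q)) · q^ε for every ε > 0, uniformly in R < 1/2. -/

import Mathlib

open Real Complex MeasureTheory

noncomputable def kloostermanS (q : ℕ) (m n : ℤ) : ℂ :=
  ∑ d ∈ (Finset.range q).filter (fun d => Nat.Coprime d q),
    Complex.exp (2 * Real.pi * Complex.I *
      (((m * d + n * (((d : ZMod q)⁻¹).val : ℤ) : ℤ) : ℂ) / q))

noncomputable def enorm2 (v : ℝ × ℝ) : ℝ := Real.sqrt (v.1 ^ 2 + v.2 ^ 2)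

noncomputable def KR (R : ℝ) (x y : ℝ × ℝ) : ℝ :=
  ∑' p : ℤ × ℤ, if enorm2 (x + ((p.1 : ℝ), (p.2 : ℝ)) - y) ≤ R then (1 : ℝ) else 0

noncomputable def muVal (q : ℕ) (R : ℝ) (x : ℝ × ℝ) : ℝ :=
  (1 / (q.totient : ℝ)) *
    ∑ d ∈ (Finset.range q).filter (fun d => Nat.Coprime d q),
      KR R ((d : ℝ) / q, ((((d : ZMod q)⁻¹).val : ℕ) : ℝ) / q) x

noncomputable def varMu (q : ℕ) (R : ℝ) : ℝ :=
  ∫ x in (Set.Ioc (0 : ℝ) 1 ×ˢ Set.Ioc (0 : ℝ) 1),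
    (muVal q R x - Real.pi * R ^ 2) ^ 2

theorem succ_le_mul_two_rpow {ε : ℝ} (hε : 0 < ε) (k : ℕ) :
    (k : ℝ) + 1 ≤ (1 + 1 / (ε * Real.log 2)) * (2 : ℝ) ^ ((k : ℝ) * ε) := by
  have hL : 0 < ε * Real.log 2 := mul_pos hε (Real.log_pos (by norm_num))
  have h1 : 1 + (k : ℝ) * (ε * Real.log 2) ≤ (2 : ℝ) ^ ((k : ℝ) * ε) := by
    rw [Real.rpow_def_of_pos (by norm_num : (0 : ℝ) < 2)]
    have := Real.add_one_le_exp (Real.log 2 * (k * ε))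
    linarith
  calc (k : ℝ) + 1 ≤ (1 + 1 / (ε * Real.log 2)) * (1 + (k : ℝ) * (ε * Real.log 2)) := by
        have h2 : 1 / (ε * Real.log 2) * (k * (ε * Real.log 2)) = k := by field_simp
        have h3 : 0 < 1 / (ε * Real.log 2) := by positivity
        have h4 : 0 ≤ (k : ℝ) * (ε * Real.log 2) := by positivity
        nlinarith
    _ ≤ _ := by gcongr

theorem exists_card_divisors_le_rpow {ε : ℝ} (hε : 0 < ε) :
    ∃ C : ℝ, 0 < C ∧ ∀ n : ℕ, 0 < n → (n.divisors.card : ℝ) ≤ C * (n : ℝ) ^ ε := by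
  obtain ⟨P, hP⟩ := exists_nat_gt ((2 : ℝ) ^ (1 / ε))
  set c : ℝ := 1 + 1 / (ε * Real.log 2) with hc
  have hL : 0 < ε * Real.log 2 := mul_pos hε (Real.log_pos (by norm_num))
  have hc1 : 1 ≤ c := by
    have : 0 < 1 / (ε * Real.log 2) := by positivity
    linarith
  refine ⟨c ^ P, by positivity, fun n hn => ?_⟩
  have hn0 : n ≠ 0 := hn.ne'
  have hterm : ∀ p ∈ n.primeFactors, ((n.factorization p : ℝ) + 1) ≤
      (if p < P then c else 1) * ((p : ℝ) ^ n.factorization p) ^ ε := by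
    intro p hp
    have hpp := Nat.prime_of_mem_primeFactors hp
    have hp2 : (2 : ℝ) ≤ p := by exact_mod_cast hpp.two_le
    set k := n.factorization p
    rw [← Real.rpow_natCast, ← Real.rpow_mul (by positivity)]
    split_ifs with h
    · refine (succ_le_mul_two_rpow hε k).trans ?_
      gcongr
    · have h2 : (2 : ℝ) ≤ (p : ℝ) ^ ε := by
        have h3 : (2 : ℝ) ^ (1 / ε) ≤ p := hP.le.trans (by exact_mod_cast not_lt.mp h)
        calc (2 : ℝ) = ((2 : ℝ) ^ (1 / ε)) ^ ε := by
              rw [← Real.rpow_mul (by norm_num), one_div_mul_cancel hε.ne', Real.rpow_one]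
          _ ≤ _ := by gcongr
      rw [one_mul, mul_comm, Real.rpow_mul (by positivity), Real.rpow_natCast]
      have h4 : k + 1 ≤ 2 ^ k := Nat.lt_two_pow_self
      calc (k : ℝ) + 1 ≤ 2 ^ k := by exact_mod_cast h4
        _ ≤ _ := by gcongr
  have hprod : (n : ℝ) ^ ε = ∏ p ∈ n.primeFactors, ((p : ℝ) ^ n.factorization p) ^ ε := by
    rw [Real.finsetProd_rpow _ _ (fun i _ => by positivity)]
    congr 1
    conv_lhs => rw [← Nat.prod_factorization_pow_eq_self hn0]
    rw [Finsupp.prod, Nat.support_factorization]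
    push_cast
    rfl
  rw [Nat.card_divisors hn0, hprod]
  push_cast
  refine (Finset.prod_le_prod (fun i _ => by positivity) hterm).trans ?_
  rw [Finset.prod_mul_distrib]
  gcongr
  rw [Finset.prod_ite, Finset.prod_const, Finset.prod_const_one, mul_one]
  refine pow_le_pow_right₀ hc1 ?_
  calc _ ≤ (Finset.range P).card := Finset.card_le_card fun p hp => by
        simpa using (Finset.mem_filter.mp hp).2
    _ = P := Finset.card_range P

theorem le_totient_mul_card_divisors (n : ℕ) : n ≤ n.totient * n.divisors.card := by
  induction n using Nat.recOnPosPrimePosCoprime with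
  | zero => simp
  | one => simp
  | prime_pow p k hp hk =>
    rw [Nat.totient_prime_pow hp hk, Nat.divisors_prime_pow hp, Finset.card_map, Finset.card_range]
    obtain ⟨k, rfl⟩ := Nat.exists_eq_succ_of_ne_zero hk.ne'
    obtain ⟨r, rfl⟩ := Nat.exists_eq_add_of_le hp.two_le
    have h : (2 + r) ≤ (1 + r) * (k + 2) := by nlinarith
    calc (2 + r) ^ (k + 1) = (2 + r) ^ k * (2 + r) := pow_succ _ _
      _ ≤ (2 + r) ^ k * ((1 + r) * (k + 2)) := by gcongr
      _ = _ := by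
        have : 2 + r - 1 = 1 + r := by omega
        simp only [Nat.succ_eq_add_one, Nat.add_sub_cancel, this]
        ring
  | coprime a b _ _ hab iha ihb =>
    rw [Nat.totient_mul hab, hab.card_divisors_mul]
    calc a * b ≤ (a.totient * a.divisors.card) * (b.totient * b.divisors.card) :=
          Nat.mul_le_mul iha ihb
      _ = _ := by ring

section FiniteFourier

variable {q : ℕ} [NeZero q]

noncomputable def pairDFT (h : ZMod q × ZMod q → ℂ) (m : ZMod q × ZMod q) : ℂ :=
  ∑ a, h a * ZMod.stdAddChar (m.1 * a.1 + m.2 * a.2)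

theorem sum_stdAddChar_pair (a : ZMod q × ZMod q) :
    ∑ m : ZMod q × ZMod q, (ZMod.stdAddChar (m.1 * a.1 + m.2 * a.2) : ℂ) =
      if a = 0 then (q : ℂ) ^ 2 else 0 := by
  have hψ := ZMod.isPrimitive_stdAddChar q
  simp_rw [AddChar.map_add_eq_mul]
  rw [Fintype.sum_prod_type]
  simp_rw [← Finset.mul_sum]
  rw [← Finset.sum_mul, AddChar.sum_mulShift _ hψ, AddChar.sum_mulShift _ hψ, ZMod.card]
  by_cases h1 : a.1 = 0 <;> by_cases h2 : a.2 = 0 <;> simp [Prod.ext_iff, h1, h2, sq]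

theorem sum_norm_sq_pairDFT (h : ZMod q × ZMod q → ℂ) :
    ∑ m, ‖pairDFT h m‖ ^ 2 = (q : ℝ) ^ 2 * ∑ a, ‖h a‖ ^ 2 := by
  have hC : ∑ m, (pairDFT h m * (starRingEnd ℂ) (pairDFT h m)) =
      (q : ℂ) ^ 2 * ∑ a, h a * (starRingEnd ℂ) (h a) := by
    have hexp : ∀ m, pairDFT h m * (starRingEnd ℂ) (pairDFT h m) =
        ∑ a, ∑ b, h a * (starRingEnd ℂ) (h b) *
          (ZMod.stdAddChar (m.1 * (a - b).1 + m.2 * (a - b).2) : ℂ) := by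
      intro m
      rw [pairDFT, map_sum, Finset.sum_mul_sum]
      refine Finset.sum_congr rfl fun a _ => Finset.sum_congr rfl fun b _ => ?_
      rw [map_mul, ← AddChar.map_neg_eq_conj]
      have : m.1 * (a - b).1 + m.2 * (a - b).2 =
          (m.1 * a.1 + m.2 * a.2) + -(m.1 * b.1 + m.2 * b.2) := by
        simp only [Prod.fst_sub, Prod.snd_sub]; ring
      rw [this, AddChar.map_add_eq_mul (ZMod.stdAddChar (N := q)) (m.1 * a.1 + m.2 * a.2)]
      ring
    simp_rw [hexp]
    rw [Finset.sum_comm, Finset.mul_sum]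
    refine Finset.sum_congr rfl fun a _ => ?_
    rw [Finset.sum_comm]
    simp_rw [← Finset.mul_sum, sum_stdAddChar_pair, sub_eq_zero]
    simp [mul_comm]
  simp_rw [Complex.mul_conj, Complex.normSq_eq_norm_sq] at hC
  exact_mod_cast hC

theorem sum_norm_sq_sum_translates {ι : Type*} (s : Finset ι) (w : ι → ZMod q × ZMod q)
    (h : ZMod q × ZMod q → ℂ) :
    (q : ℝ) ^ 2 * ∑ b, ‖∑ i ∈ s, h (w i - b)‖ ^ 2 =
      ∑ m, ‖pairDFT h (-m)‖ ^ 2 *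
        ‖∑ i ∈ s, (ZMod.stdAddChar (m.1 * (w i).1 + m.2 * (w i).2) : ℂ)‖ ^ 2 := by
  rw [← sum_norm_sq_pairDFT]
  refine Finset.sum_congr rfl fun m _ => ?_
  rw [← mul_pow, ← norm_mul]
  congr 2
  simp only [pairDFT]
  simp_rw [Finset.sum_mul]
  rw [Finset.sum_comm]
  simp_rw [Finset.mul_sum]
  rw [Finset.sum_comm (s := Finset.univ)]
  refine Finset.sum_congr rfl fun i _ => ?_
  refine Fintype.sum_equiv (Equiv.subLeft (w i)) _ _ fun b => ?_
  simp only [Equiv.subLeft_apply]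
  rw [mul_assoc, ← AddChar.map_add_eq_mul]
  congr 2
  simp only [Prod.fst_sub, Prod.snd_sub, Prod.fst_neg, Prod.snd_neg]
  ring

theorem kloostermanS_val (m : ZMod q × ZMod q) :
    kloostermanS q m.1.val m.2.val =
      ∑ d ∈ (Finset.range q).filter (fun d => Nat.Coprime d q),
        (ZMod.stdAddChar (m.1 * (d : ZMod q) + m.2 * (d : ZMod q)⁻¹) : ℂ) := by
  refine Finset.sum_congr rfl fun d _ => ?_
  have := ZMod.stdAddChar_coe (N := q) ((m.1.val : ℤ) * d + m.2.val * (((d : ZMod q)⁻¹).val : ℤ))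
  rw [mul_div_assoc] at this
  rw [← this]
  simp

theorem sum_sq_hyperbola_translates_le
    (hWeil : ∀ m n : ℤ, ¬(m = 0 ∧ n = 0) →
      ‖kloostermanS q m n‖ ≤ (q.divisors.card : ℝ) *
        Real.sqrt ((Int.gcd (Int.gcd m n) (q : ℤ) : ℝ) * q))
    (h : ZMod q × ZMod q → ℝ) (h0 : ∑ a, h a = 0) :
    ∑ b : ZMod q × ZMod q, (∑ d ∈ (Finset.range q).filter (fun d => Nat.Coprime d q),
        h (((d : ZMod q), (d : ZMod q)⁻¹) - b)) ^ 2 ≤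
      (q.divisors.card : ℝ) ^ 2 * q * ∑ g ∈ q.divisors, ((g : ℝ) ^ 3)⁻¹ *
        ∑ b : ZMod q × ZMod q, (∑ j : Fin g × Fin g,
          h ((((q / g * j.1 : ℕ) : ZMod q), ((q / g * j.2 : ℕ) : ZMod q)) - b)) ^ 2 := by
  have hq : (0 : ℝ) < (q : ℝ) ^ 2 := by
    have : 0 < q := Nat.pos_of_neZero q
    positivity
  have hreal : ∀ {ι : Type} (s : Finset ι) (w : ι → ZMod q × ZMod q),
      (q : ℝ) ^ 2 * ∑ b, (∑ i ∈ s, h (w i - b)) ^ 2 =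
        ∑ m, ‖pairDFT (fun a => (h a : ℂ)) (-m)‖ ^ 2 *
        ‖∑ i ∈ s, (ZMod.stdAddChar (m.1 * (w i).1 + m.2 * (w i).2) : ℂ)‖ ^ 2 := by
    intro ι s w
    rw [← sum_norm_sq_sum_translates]
    congr 1
    refine Finset.sum_congr rfl fun b _ => ?_
    rw [← Complex.ofReal_sum, Complex.norm_real, Real.norm_eq_abs, sq_abs]
  refine le_of_mul_le_mul_left ?_ hq
  set H : ZMod q × ZMod q → ℝ := fun m => ‖pairDFT (fun a => (h a : ℂ)) (-m)‖ ^ 2 with hH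
  have hH0 : H 0 = 0 := by
    have : pairDFT (fun a => (h a : ℂ)) 0 = 0 := by
      simp [pairDFT, ← Complex.ofReal_sum, h0]
    simp [hH, this]
  have hHnn : ∀ m, 0 ≤ H m := fun m => by positivity
  have hperiod : ∀ g ∈ q.divisors,
      (g : ℝ) ^ 4 * ∑ m with (g ∣ m.1.val ∧ g ∣ m.2.val), H m ≤
      (q : ℝ) ^ 2 * ∑ b : ZMod q × ZMod q, (∑ j : Fin g × Fin g,
          h ((((q / g * j.1 : ℕ) : ZMod q), ((q / g * j.2 : ℕ) : ZMod q)) - b)) ^ 2 := by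
    intro g hg
    rw [hreal Finset.univ (fun j : Fin g × Fin g =>
      (((q / g * j.1 : ℕ) : ZMod q), ((q / g * j.2 : ℕ) : ZMod q))), Finset.mul_sum,
      Finset.sum_filter]
    refine Finset.sum_le_sum fun m _ => ?_
    split_ifs with hm
    · have hone : ∀ j : Fin g × Fin g, (ZMod.stdAddChar (m.1 * ((q / g * j.1 : ℕ) : ZMod q) +
          m.2 * ((q / g * j.2 : ℕ) : ZMod q)) : ℂ) = 1 := by
        intro j
        have : m.1 * ((q / g * j.1 : ℕ) : ZMod q) + m.2 * ((q / g * j.2 : ℕ) : ZMod q) = 0 := by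
          obtain ⟨⟨u, hu⟩, ⟨v, hv⟩⟩ := hm
          have hqg : g * (q / g) = q := Nat.mul_div_cancel' (Nat.dvd_of_mem_divisors hg)
          have e : ((g * (q / g) : ℕ) : ZMod q) = 0 := by rw [hqg]; simp
          rw [← ZMod.natCast_zmod_val m.1, ← ZMod.natCast_zmod_val m.2, hu, hv]
          push_cast at e ⊢
          linear_combination (u * j.1 + v * j.2 : ZMod q) * e
        rw [this, AddChar.map_zero_eq_one]
      simp_rw [hone]
      simp only [Finset.sum_const, Finset.card_univ, Fintype.card_prod, Fintype.card_fin,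
        nsmul_eq_mul, mul_one]
      rw [Complex.norm_natCast]
      push_cast
      apply le_of_eq
      ring
    · positivity
  have hweil : ∀ m : ZMod q × ZMod q,
      H m * ‖∑ d ∈ (Finset.range q).filter (fun d => Nat.Coprime d q),
        (ZMod.stdAddChar (m.1 * (d : ZMod q) + m.2 * (d : ZMod q)⁻¹) : ℂ)‖ ^ 2 ≤
      (q.divisors.card : ℝ) ^ 2 * q *
        ∑ g ∈ q.divisors, if (g ∣ m.1.val ∧ g ∣ m.2.val) then g * H m else 0 := by
    intro m
    by_cases hm : m = 0
    · subst hm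
      rw [hH0, zero_mul]
      simp
    have hm' : ¬((m.1.val : ℤ) = 0 ∧ (m.2.val : ℤ) = 0) := by
      rintro ⟨h1, h2⟩
      apply hm
      ext1
      · exact (ZMod.val_eq_zero _).mp (by exact_mod_cast h1)
      · exact (ZMod.val_eq_zero _).mp (by exact_mod_cast h2)
    have hb := hWeil _ _ hm'
    rw [kloostermanS_val] at hb
    set g := Int.gcd (Int.gcd (m.1.val : ℤ) (m.2.val : ℤ)) (q : ℤ) with hg
    have hgq : g ∈ q.divisors := by
      rw [Nat.mem_divisors]
      refine ⟨?_, NeZero.ne q⟩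
      rw [hg, Int.gcd_natCast_natCast]
      exact Nat.gcd_dvd_right _ _
    have hgm : g ∣ m.1.val ∧ g ∣ m.2.val := by
      rw [hg, Int.gcd_natCast_natCast, Int.gcd_natCast_natCast]
      exact ⟨(Nat.gcd_dvd_left _ _).trans (Nat.gcd_dvd_left _ _),
        (Nat.gcd_dvd_left _ _).trans (Nat.gcd_dvd_right _ _)⟩
    have h1 : (g : ℝ) * H m ≤
        ∑ g ∈ q.divisors, if (g ∣ m.1.val ∧ g ∣ m.2.val) then (g : ℝ) * H m else 0 := by
      have := Finset.single_le_sum (s := q.divisors)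
        (f := fun g : ℕ => if (g ∣ m.1.val ∧ g ∣ m.2.val) then (g : ℝ) * H m else 0)
        (fun i _ => by have := hHnn m; split_ifs <;> positivity) hgq
      simpa [hgm] using this
    calc _ ≤ H m * ((q.divisors.card : ℝ) * Real.sqrt ((g : ℝ) * q)) ^ 2 := by
          have := hHnn m
          gcongr
      _ = (q.divisors.card : ℝ) ^ 2 * q * (g * H m) := by
          rw [mul_pow, Real.sq_sqrt (by positivity)]
          ring
      _ ≤ _ := by gcongr
  rw [hreal _ (fun d : ℕ => ((d : ZMod q), (d : ZMod q)⁻¹))]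
  refine (Finset.sum_le_sum fun m _ => hweil m).trans ?_
  rw [← Finset.mul_sum, Finset.sum_comm, mul_left_comm]
  gcongr
  rw [Finset.mul_sum]
  refine Finset.sum_le_sum fun g hg => ?_
  have hgpos : 0 < g := Nat.pos_of_mem_divisors hg
  rw [← Finset.sum_filter, ← Finset.mul_sum, mul_left_comm, ← div_eq_inv_mul, le_div_iff₀ (by positivity)]
  refine le_trans (le_of_eq ?_) (hperiod g hg)
  ring

end FiniteFourier

section LatticeCount

theorem enorm2_eq_norm (v : ℝ × ℝ) : enorm2 v = ‖Complex.equivRealProd.symm v‖ := by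
  rw [Complex.norm_eq_sqrt_sq_add_sq]
  rfl

theorem enorm2_add_le (v w : ℝ × ℝ) : enorm2 (v + w) ≤ enorm2 v + enorm2 w := by
  simp only [enorm2_eq_norm]
  have : Complex.equivRealProd.symm (v + w) =
      Complex.equivRealProd.symm v + Complex.equivRealProd.symm w := by
    apply Complex.ext <;> simp
  rw [this]
  exact norm_add_le _ _

theorem enorm2_neg (v : ℝ × ℝ) : enorm2 (-v) = enorm2 v := by
  simp [enorm2]

theorem enorm2_smul {g : ℝ} (hg : 0 ≤ g) (v : ℝ × ℝ) : enorm2 (g • v) = g * enorm2 v := by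
  simp only [enorm2, Prod.smul_fst, Prod.smul_snd, smul_eq_mul]
  rw [show (g * v.1) ^ 2 + (g * v.2) ^ 2 = g ^ 2 * (v.1 ^ 2 + v.2 ^ 2) by ring,
    Real.sqrt_mul (sq_nonneg g), Real.sqrt_sq hg]

theorem abs_fst_le_enorm2 (v : ℝ × ℝ) : |v.1| ≤ enorm2 v := by
  refine Real.abs_le_sqrt ?_
  nlinarith [sq_nonneg v.2]

theorem abs_snd_le_enorm2 (v : ℝ × ℝ) : |v.2| ≤ enorm2 v := by
  refine Real.abs_le_sqrt ?_
  nlinarith [sq_nonneg v.1]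

theorem continuous_enorm2 : Continuous enorm2 := by
  unfold enorm2
  fun_prop

theorem volume_enorm2_le {r : ℝ} (hr : 0 ≤ r) :
    volume {v : ℝ × ℝ | enorm2 v ≤ r} = ENNReal.ofReal (Real.pi * r ^ 2) := by
  have hs : {v : ℝ × ℝ | enorm2 v ≤ r} =
      Complex.measurableEquivRealProd.symm ⁻¹' Metric.closedBall 0 r := by
    ext v
    simp only [Set.mem_ofPred_eq, Set.mem_preimage, mem_closedBall_zero_iff, enorm2_eq_norm]
    rfl
  rw [hs, Complex.volume_preserving_equiv_real_prod.symm.measure_preimage_equiv,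
    Complex.volume_closedBall, mul_comm, ← ENNReal.ofReal_pow hr,
    ENNReal.ofReal_mul Real.pi_pos.le]
  congr 1
  rw [← NNReal.coe_real_pi, ENNReal.ofReal_coe_nnreal]

theorem finite_lattice_points (r : ℝ) (x y : ℝ × ℝ) :
    {p : ℤ × ℤ | enorm2 (x + ((p.1 : ℝ), (p.2 : ℝ)) - y) ≤ r}.Finite := by
  refine ((Set.finite_Icc ⌊y.1 - x.1 - r⌋ ⌈y.1 - x.1 + r⌉).prod
    (Set.finite_Icc ⌊y.2 - x.2 - r⌋ ⌈y.2 - x.2 + r⌉)).subset fun p hp => ?_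
  have h1 := abs_le.mp ((abs_fst_le_enorm2 _).trans hp)
  have h2 := abs_le.mp ((abs_snd_le_enorm2 _).trans hp)
  simp only [Prod.fst_add, Prod.fst_sub, Prod.snd_add, Prod.snd_sub] at h1 h2
  refine ⟨⟨Int.floor_le_iff.mpr ?_, Int.le_ceil_iff.mpr ?_⟩,
    ⟨Int.floor_le_iff.mpr ?_, Int.le_ceil_iff.mpr ?_⟩⟩ <;> linarith [h1.1, h1.2, h2.1, h2.2]

theorem summable_KR (r : ℝ) (x y : ℝ × ℝ) : Summable fun p : ℤ × ℤ =>
    if enorm2 (x + ((p.1 : ℝ), (p.2 : ℝ)) - y) ≤ r then (1 : ℝ) else 0 := by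
  refine summable_of_hasFiniteSupport ((finite_lattice_points r x y).subset fun p hp => ?_)
  by_contra h
  exact hp (if_neg h)

theorem KR_nonneg (r : ℝ) (x y : ℝ × ℝ) : 0 ≤ KR r x y :=
  tsum_nonneg fun _ => by split_ifs <;> norm_num

theorem KR_congr_sub (r : ℝ) {x y x' y' : ℝ × ℝ} (h : x - y = x' - y') :
    KR r x y = KR r x' y' := by
  refine tsum_congr fun p => ?_
  rw [add_sub_right_comm, h, add_sub_right_comm]

theorem KR_add_int (r : ℝ) (x y : ℝ × ℝ) (m n : ℤ) :
    KR r (x + ((m : ℝ), (n : ℝ))) y = KR r x y := by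
  refine (tsum_congr fun p => ?_).trans ((Equiv.addLeft (m, n)).tsum_eq fun p : ℤ × ℤ =>
    if enorm2 (x + ((p.1 : ℝ), (p.2 : ℝ)) - y) ≤ r then (1 : ℝ) else 0)
  have : x + ((m : ℝ), (n : ℝ)) + ((p.1 : ℝ), (p.2 : ℝ)) =
      x + ((((m, n) + p : ℤ × ℤ).1 : ℝ), (((m, n) + p : ℤ × ℤ).2 : ℝ)) := by
    ext <;> simp [add_assoc]
  rw [this]
  rfl

theorem KR_le_KR_add (r δ : ℝ) (x y v : ℝ × ℝ) (hv : enorm2 v ≤ δ) :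
    KR r x y ≤ KR (r + δ) x (y + v) := by
  refine (summable_KR _ _ _).tsum_le_tsum (fun p => ?_) (summable_KR _ _ _)
  have h : enorm2 (x + ((p.1 : ℝ), (p.2 : ℝ)) - (y + v)) ≤
      enorm2 (x + ((p.1 : ℝ), (p.2 : ℝ)) - y) + enorm2 v := by
    rw [← sub_sub, sub_eq_add_neg _ v, ← enorm2_neg v]
    exact enorm2_add_le _ _
  split_ifs with h1 h2
  · exact le_rfl
  · exact absurd (by linarith) h2
  · norm_num
  · exact le_rfl

theorem KR_scale {g : ℕ} (hg : 0 < g) (R : ℝ) (x y : ℝ × ℝ) :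
    KR (g * R) ((g : ℝ) • x) ((g : ℝ) • y) =
      ∑ j : Fin g × Fin g, KR R (x + ((j.1 : ℝ) / g, (j.2 : ℝ) / g)) y := by
  have : NeZero g := ⟨hg.ne'⟩
  have hg' : (0 : ℝ) < g := by exact_mod_cast hg
  let e : (ℤ × ℤ) × (Fin g × Fin g) ≃ ℤ × ℤ :=
    (Equiv.prodProdProdComm ℤ ℤ (Fin g) (Fin g)).trans
      ((Int.divModEquiv g).symm.prodCongr (Int.divModEquiv g).symm)
  have hterm : ∀ (p : ℤ × ℤ) (j : Fin g × Fin g),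
      enorm2 ((g : ℝ) • x + (((e (p, j)).1 : ℝ), ((e (p, j)).2 : ℝ)) - (g : ℝ) • y) =
        g * enorm2 (x + ((j.1 : ℝ) / g, (j.2 : ℝ) / g) + ((p.1 : ℝ), (p.2 : ℝ)) - y) := by
    intro p j
    rw [← enorm2_smul hg'.le]
    congr 1
    ext
    · simp [e, Int.divModEquiv]
      field_simp
      ring
    · simp [e, Int.divModEquiv]
      field_simp
      ring
  have hsum := (e.summable_iff).mpr (summable_KR (g * R) ((g : ℝ) • x) ((g : ℝ) • y))
  simp only [KR]
  rw [← Summable.tsum_finsetSum fun j _ => summable_KR _ _ _, ← e.tsum_eq]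
  refine hsum.tsum_prod.trans ?_
  refine tsum_congr fun p => ?_
  rw [tsum_fintype]
  refine Finset.sum_congr rfl fun j _ => ?_
  simp only [Function.comp_apply, hterm, mul_le_mul_iff_right₀ hg']

theorem isAddFundamentalDomain_unitSquare :
    IsAddFundamentalDomain
      ((AddSubgroup.zmultiples (1 : ℝ)).prod (AddSubgroup.zmultiples (1 : ℝ)))
      (Set.Ioc (0 : ℝ) 1 ×ˢ Set.Ioc (0 : ℝ) 1) (volume : Measure (ℝ × ℝ)) := by
  refine IsAddFundamentalDomain.mk'
    (measurableSet_Ioc.prod measurableSet_Ioc).nullMeasurableSet fun x => ?_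
  obtain ⟨m, hm, hm'⟩ := existsUnique_add_zsmul_mem_Ioc one_pos x.1 0
  obtain ⟨n, hn, hn'⟩ := existsUnique_add_zsmul_mem_Ioc one_pos x.2 0
  refine ⟨⟨(m • 1, n • 1), ⟨m, rfl⟩, ⟨n, rfl⟩⟩, ?_, ?_⟩
  · constructor
    · simpa [AddSubgroup.vadd_def, add_comm] using hm
    · simpa [AddSubgroup.vadd_def, add_comm] using hn
  · rintro ⟨⟨a, b⟩, ⟨m₁, rfl : m₁ • (1 : ℝ) = a⟩, ⟨n₁, rfl : n₁ • (1 : ℝ) = b⟩⟩ ⟨h1, h2⟩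
    have e1 : m₁ = m := hm' _ (by simpa [AddSubgroup.vadd_def, add_comm] using h1)
    have e2 : n₁ = n := hn' _ (by simpa [AddSubgroup.vadd_def, add_comm] using h2)
    subst e1 e2
    rfl

noncomputable def intPairEquivLattice : ℤ × ℤ ≃
    (AddSubgroup.zmultiples (1 : ℝ)).prod (AddSubgroup.zmultiples (1 : ℝ)) :=
  Equiv.ofBijective (fun p => ⟨((p.1 : ℝ), (p.2 : ℝ)), ⟨p.1, by simp⟩, ⟨p.2, by simp⟩⟩) <| by
    constructor
    · rintro ⟨a, b⟩ ⟨c, d⟩ h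
      have h' := Prod.ext_iff.mp (Subtype.ext_iff.mp h)
      exact Prod.ext (Int.cast_injective h'.1) (Int.cast_injective h'.2)
    · rintro ⟨⟨a, b⟩, ⟨m₁, rfl : m₁ • (1 : ℝ) = a⟩, ⟨n₁, rfl : n₁ • (1 : ℝ) = b⟩⟩
      exact ⟨(m₁, n₁), by simp⟩

instance countable_zmultiples_one_prod :
    Countable ((AddSubgroup.zmultiples (1 : ℝ)).prod (AddSubgroup.zmultiples (1 : ℝ))) :=
  .of_equiv _ intPairEquivLattice

theorem ofReal_KR (r : ℝ) (x y : ℝ × ℝ) :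
    ENNReal.ofReal (KR r x y) =
      ∑' p : ℤ × ℤ, Set.indicator {v | enorm2 v ≤ r} (1 : ℝ × ℝ → ENNReal)
        (-((p.1 : ℝ), (p.2 : ℝ)) + y - x) := by
  rw [KR, ENNReal.ofReal_tsum_of_nonneg (fun _ => by split_ifs <;> norm_num) (summable_KR r x y)]
  refine tsum_congr fun p => ?_
  have : enorm2 (-((p.1 : ℝ), (p.2 : ℝ)) + y - x) = enorm2 (x + ((p.1 : ℝ), (p.2 : ℝ)) - y) := by
    rw [← enorm2_neg]
    congr 1
    abel
  simp only [Set.indicator, Set.mem_ofPred_eq, this, Pi.one_apply]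
  split_ifs <;> simp

theorem measurableSet_enorm2_le (r : ℝ) : MeasurableSet {v | enorm2 v ≤ r} :=
  (isClosed_le continuous_enorm2 continuous_const).measurableSet

theorem measurable_ofReal_KR (r : ℝ) (x : ℝ × ℝ) :
    Measurable fun y => ENNReal.ofReal (KR r x y) := by
  simp_rw [ofReal_KR]
  refine Measurable.tsum fun p => ?_
  exact (measurable_one.indicator (measurableSet_enorm2_le r)).comp (by fun_prop)

theorem measurable_KR (r : ℝ) (x : ℝ × ℝ) : Measurable fun y => KR r x y := by
  have := (measurable_ofReal_KR r x).ennreal_toReal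
  simpa only [ENNReal.toReal_ofReal (KR_nonneg r x _)] using this

theorem lintegral_KR {r : ℝ} (hr : 0 ≤ r) (x : ℝ × ℝ) :
    ∫⁻ y in Set.Ioc (0 : ℝ) 1 ×ˢ Set.Ioc (0 : ℝ) 1, ENNReal.ofReal (KR r x y) =
      ENNReal.ofReal (Real.pi * r ^ 2) := by
  have hmeas := (measurable_one (α := ENNReal) (β := ℝ × ℝ)).indicator (measurableSet_enorm2_le r)
  simp_rw [ofReal_KR]
  have hmeas' : ∀ p : ℤ × ℤ, Measurable fun y : ℝ × ℝ =>
      Set.indicator {v | enorm2 v ≤ r} (1 : ℝ × ℝ → ENNReal) (-((p.1 : ℝ), (p.2 : ℝ)) + y - x) :=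
    fun p => hmeas.comp (by fun_prop)
  rw [lintegral_tsum fun p => (hmeas' p).aemeasurable]
  have h := isAddFundamentalDomain_unitSquare.lintegral_eq_tsum' fun y =>
    Set.indicator {v | enorm2 v ≤ r} (1 : ℝ × ℝ → ENNReal) (y - x)
  rw [lintegral_sub_right_eq_self, lintegral_indicator_one (measurableSet_enorm2_le r),
    volume_enorm2_le hr, ← intPairEquivLattice.tsum_eq] at h
  exact h.symm

theorem integral_KR {r : ℝ} (hr : 0 ≤ r) (x : ℝ × ℝ) :
    ∫ y in Set.Ioc (0 : ℝ) 1 ×ˢ Set.Ioc (0 : ℝ) 1, KR r x y = Real.pi * r ^ 2 := by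
  rw [integral_eq_lintegral_of_nonneg_ae (Filter.Eventually.of_forall fun y => KR_nonneg r x y)
    (measurable_KR r x).aestronglyMeasurable, lintegral_KR hr,
    ENNReal.toReal_ofReal (by positivity)]

theorem integrableOn_KR {r : ℝ} (hr : 0 ≤ r) (x : ℝ × ℝ) :
    IntegrableOn (KR r x) (Set.Ioc (0 : ℝ) 1 ×ˢ Set.Ioc (0 : ℝ) 1) := by
  refine ⟨(measurable_KR r x).aestronglyMeasurable, ?_⟩
  rw [hasFiniteIntegral_iff_ofReal (Filter.Eventually.of_forall fun y => KR_nonneg r x y),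
    lintegral_KR hr]
  exact ENNReal.ofReal_lt_top

theorem volume_unitSquare :
    (volume : Measure (ℝ × ℝ)) (Set.Ioc (0 : ℝ) 1 ×ˢ Set.Ioc (0 : ℝ) 1) = 1 := by
  rw [Measure.volume_eq_prod, Measure.prod_prod]
  simp

theorem enorm2_le_two_of_mem_unitSquare {v : ℝ × ℝ}
    (hv : v ∈ Set.Ioc (0 : ℝ) 1 ×ˢ Set.Ioc (0 : ℝ) 1) : enorm2 v ≤ 2 := by
  obtain ⟨⟨h1, h2⟩, ⟨h3, h4⟩⟩ := hv
  refine Real.sqrt_le_iff.mpr ⟨by norm_num, by nlinarith⟩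

theorem abs_KR_sub_le {r : ℝ} (hr : 0 ≤ r) (x y : ℝ × ℝ) :
    |KR r x y - Real.pi * r ^ 2| ≤ Real.pi * (4 * r + 4) := by
  have hpi := Real.pi_pos
  have hms : MeasurableSet (Set.Ioc (0 : ℝ) 1 ×ˢ Set.Ioc (0 : ℝ) 1) :=
    measurableSet_Ioc.prod measurableSet_Ioc
  have hconst : ∫ _ in Set.Ioc (0 : ℝ) 1 ×ˢ Set.Ioc (0 : ℝ) 1, KR r x y = KR r x y := by
    rw [setIntegral_const]
    simp [Measure.real, volume_unitSquare]
  have hint : IntegrableOn (fun _ : ℝ × ℝ => KR r x y)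
      (Set.Ioc (0 : ℝ) 1 ×ˢ Set.Ioc (0 : ℝ) 1) :=
    integrableOn_const (by rw [volume_unitSquare]; exact ENNReal.one_ne_top)
  have hshift : ∀ (ρ : ℝ) (v : ℝ × ℝ), KR ρ x (y + v) = KR ρ (x - y) v := fun ρ v =>
    KR_congr_sub ρ (by abel)
  have hup : KR r x y ≤ Real.pi * (r + 2) ^ 2 := by
    rw [← hconst, ← integral_KR (by linarith) (x - y)]
    refine setIntegral_mono_on hint (integrableOn_KR (by linarith) _) hms fun v hv => ?_
    rw [← hshift]
    exact KR_le_KR_add _ _ _ _ _ (enorm2_le_two_of_mem_unitSquare hv)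
  have hlow : Real.pi * r ^ 2 - Real.pi * (4 * r + 4) ≤ KR r x y := by
    rcases le_total 2 r with h2 | h2
    · have : Real.pi * (r - 2) ^ 2 ≤ KR r x y := by
        rw [← hconst, ← integral_KR (by linarith) (x - y)]
        refine setIntegral_mono_on (integrableOn_KR (by linarith) _) hint hms fun v hv => ?_
        rw [← hshift]
        have := KR_le_KR_add (r - 2) 2 x (y + v) (-v)
          ((enorm2_neg v).trans_le (enorm2_le_two_of_mem_unitSquare hv))
        simpa using this
      nlinarith
    · have := KR_nonneg r x y
      nlinarith [mul_nonneg hr (sub_nonneg.mpr h2)]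
  rw [abs_le]
  constructor <;> nlinarith

theorem setIntegral_unitSquare_comp_add {f : ℝ × ℝ → ℝ}
    (hf : ∀ (m n : ℤ) x, f (x + ((m : ℝ), (n : ℝ))) = f x) (v : ℝ × ℝ) :
    ∫ x in Set.Ioc (0 : ℝ) 1 ×ˢ Set.Ioc (0 : ℝ) 1, f (x + v) =
      ∫ x in Set.Ioc (0 : ℝ) 1 ×ˢ Set.Ioc (0 : ℝ) 1, f x := by
  have h1 := isAddFundamentalDomain_unitSquare
  have h2 := h1.vadd_of_comm v
  have hinv : ∀ (g : (AddSubgroup.zmultiples (1 : ℝ)).prod (AddSubgroup.zmultiples (1 : ℝ))) x,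
      f (g +ᵥ x) = f x := by
    rintro ⟨⟨a, b⟩, ⟨m, rfl : m • (1 : ℝ) = a⟩, ⟨n, rfl : n • (1 : ℝ) = b⟩⟩ x
    rw [← hf m n x]
    congr 1
    simp [AddSubgroup.vadd_def, add_comm]
  rw [h1.setIntegral_eq h2 hinv]
  have := (measurePreserving_vadd v (volume : Measure (ℝ × ℝ))).setIntegral_image_emb
    (measurableEmbedding_const_vadd v) f (Set.Ioc (0 : ℝ) 1 ×ˢ Set.Ioc (0 : ℝ) 1)
  simp_rw [add_comm _ v]
  exact this.symm

end LatticeCount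

theorem KR_add_int_right (r : ℝ) (x y : ℝ × ℝ) (m n : ℤ) :
    KR r x (y + ((m : ℝ), (n : ℝ))) = KR r x y := by
  rw [← KR_add_int r x y (-m) (-n)]
  refine KR_congr_sub r ?_
  ext <;> simp <;> ring

theorem muVal_add_int (q : ℕ) (R : ℝ) (x : ℝ × ℝ) (m n : ℤ) :
    muVal q R (x + ((m : ℝ), (n : ℝ))) = muVal q R x := by
  simp only [muVal, KR_add_int_right]

theorem memLp_muVal_add (q : ℕ) {R : ℝ} (hR : 0 ≤ R) (v : ℝ × ℝ) :
    MemLp (fun x => muVal q R (x + v)) 2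
      (volume.restrict (Set.Ioc (0 : ℝ) 1 ×ˢ Set.Ioc (0 : ℝ) 1)) := by
  have : IsFiniteMeasure ((volume : Measure (ℝ × ℝ)).restrict
      (Set.Ioc (0 : ℝ) 1 ×ˢ Set.Ioc (0 : ℝ) 1)) :=
    ⟨by rw [Measure.restrict_apply_univ, volume_unitSquare]; exact ENNReal.one_lt_top⟩
  have hKR : ∀ c : ℝ × ℝ, MemLp (fun x => KR R c (x + v)) 2
      (volume.restrict (Set.Ioc (0 : ℝ) 1 ×ˢ Set.Ioc (0 : ℝ) 1)) := by
    intro c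
    have hmeas : Measurable fun x => KR R c (x + v) :=
      (measurable_KR R c).comp (measurable_id.add_const v)
    refine MemLp.of_bound hmeas.aestronglyMeasurable (Real.pi * R ^ 2 + Real.pi * (4 * R + 4))
      (Filter.Eventually.of_forall fun x => ?_)
    rw [Real.norm_of_nonneg (KR_nonneg _ _ _)]
    linarith [(abs_le.mp (abs_KR_sub_le hR c (x + v))).2]
  exact (memLp_finsetSum ((Finset.range q).filter (fun d => Nat.Coprime d q))
    fun d _ => hKR ((d : ℝ) / q, ((((d : ZMod q)⁻¹).val : ℕ) : ℝ) / q)).const_mul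
      (1 / (q.totient : ℝ))

section Grid

variable {q : ℕ} [NeZero q]

noncomputable def gridKR (q : ℕ) (R : ℝ) (x : ℝ × ℝ) (a : ZMod q × ZMod q) : ℝ :=
  KR R ((a.1.val : ℝ) / q, (a.2.val : ℝ) / q) x

noncomputable def gridPoint (b : ZMod q × ZMod q) : ℝ × ℝ :=
  ((b.1.val : ℝ) / q, (b.2.val : ℝ) / q)

theorem exists_val_sub_div (c : ℕ) (b : ZMod q) :
    ∃ k : ℤ, (((c : ZMod q) - b).val : ℝ) / q = ((c : ℝ) / q - (b.val : ℝ) / q) + k := by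
  have hq : (q : ℝ) ≠ 0 := by exact_mod_cast NeZero.ne q
  have h : ((c : ZMod q) - b) = (((c : ℤ) - (b.val : ℤ) : ℤ) : ZMod q) := by simp
  have h2 : ((((c : ZMod q) - b).val : ℤ) : ℤ) =
      ((c : ℤ) - b.val) - q * (((c : ℤ) - b.val) / q) := by
    rw [h, ZMod.val_intCast, Int.emod_def]
  refine ⟨-(((c : ℤ) - b.val) / q), ?_⟩
  have h3 : ((((c : ZMod q) - b).val : ℕ) : ℝ) =
      ((c : ℝ) - b.val) - q * ((((c : ℤ) - b.val) / (q : ℤ) : ℤ) : ℝ) := by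
    exact_mod_cast h2
  rw [h3]
  push_cast
  field_simp
  ring

theorem gridKR_natCast_sub (R : ℝ) (x : ℝ × ℝ) (c₁ c₂ : ℕ) (b : ZMod q × ZMod q) :
    gridKR q R x (((c₁ : ZMod q), (c₂ : ZMod q)) - b) =
      KR R ((c₁ : ℝ) / q, (c₂ : ℝ) / q) (x + gridPoint b) := by
  obtain ⟨k₁, h₁⟩ := exists_val_sub_div c₁ b.1
  obtain ⟨k₂, h₂⟩ := exists_val_sub_div c₂ b.2
  rw [gridKR, Prod.fst_sub, Prod.snd_sub, h₁, h₂]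
  have := KR_add_int R ((c₁ : ℝ) / q - (b.1.val : ℝ) / q, (c₂ : ℝ) / q - (b.2.val : ℝ) / q) x k₁ k₂
  rw [Prod.mk_add_mk] at this
  rw [this]
  refine KR_congr_sub R ?_
  ext <;> simp [gridPoint] <;> ring

theorem muVal_add_gridPoint (R : ℝ) (x : ℝ × ℝ) (b : ZMod q × ZMod q) :
    muVal q R (x + gridPoint b) = (1 / (q.totient : ℝ)) *
      ∑ d ∈ (Finset.range q).filter (fun d => Nat.Coprime d q),
        gridKR q R x (((d : ZMod q), (d : ZMod q)⁻¹) - b) := by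
  rw [muVal]
  congr 1
  refine Finset.sum_congr rfl fun d _ => ?_
  rw [← gridKR_natCast_sub, ZMod.natCast_zmod_val]

theorem sum_gridKR_torsion (R : ℝ) (x : ℝ × ℝ) {g : ℕ} (hg : g ∣ q) (b : ZMod q × ZMod q) :
    ∑ j : Fin g × Fin g,
      gridKR q R x ((((q / g * j.1 : ℕ) : ZMod q), ((q / g * j.2 : ℕ) : ZMod q)) - b) =
      KR (g * R) 0 ((g : ℝ) • (x + gridPoint b)) := by
  have hq : 0 < q := Nat.pos_of_neZero q
  have hg0 : 0 < g := Nat.pos_of_dvd_of_pos hg hq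
  have hgr : (g : ℝ) ≠ 0 := by exact_mod_cast hg0.ne'
  have hqr : (q : ℝ) ≠ 0 := by exact_mod_cast hq.ne'
  have hdiv : ∀ j : ℕ, ((q / g * j : ℕ) : ℝ) / q = (j : ℝ) / g := by
    intro j
    rw [Nat.cast_mul, Nat.cast_div hg hgr]
    field_simp
  have := KR_scale hg0 R 0 (x + gridPoint b)
  rw [smul_zero] at this
  rw [this]
  refine Finset.sum_congr rfl fun j _ => ?_
  rw [gridKR_natCast_sub, hdiv, hdiv, zero_add]

theorem abs_sum_gridKR_torsion_sub_le {R : ℝ} (hR : 0 < R) (hR' : R < 1 / 2) (x : ℝ × ℝ) {g : ℕ}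
    (hg : g ∣ q) (b : ZMod q × ZMod q) :
    |∑ j : Fin g × Fin g,
      gridKR q R x ((((q / g * j.1 : ℕ) : ZMod q), ((q / g * j.2 : ℕ) : ZMod q)) - b) -
        (g : ℝ) ^ 2 * (Real.pi * R ^ 2)| ≤ 6 * Real.pi * g := by
  rw [sum_gridKR_torsion R x hg b]
  have hg1 : (1 : ℝ) ≤ g := by
    exact_mod_cast Nat.pos_of_dvd_of_pos hg (Nat.pos_of_neZero q)
  have h := abs_KR_sub_le (r := g * R) (by positivity) 0 ((g : ℝ) • (x + gridPoint b))
  rw [show (g : ℝ) ^ 2 * (Real.pi * R ^ 2) = Real.pi * (g * R) ^ 2 by ring]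
  refine h.trans ?_
  have : 4 * (g * R) + 4 ≤ 6 * g := by nlinarith
  nlinarith [Real.pi_pos]

theorem sum_gridKR_eq_sum_torsion (R : ℝ) (x : ℝ × ℝ) :
    ∑ a, gridKR q R x a = ∑ j : Fin q × Fin q,
      gridKR q R x ((((q / q * j.1 : ℕ) : ZMod q), ((q / q * j.2 : ℕ) : ZMod q)) - 0) := by
  symm
  refine Fintype.sum_bijective (fun j : Fin q × Fin q =>
    ((((q / q * j.1 : ℕ) : ZMod q), ((q / q * j.2 : ℕ) : ZMod q)) - (0 : ZMod q × ZMod q)))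
    ?_ _ _ fun _ => rfl
  rw [Fintype.bijective_iff_injective_and_card]
  refine ⟨?_, by simp [ZMod.card]⟩
  rintro ⟨i₁, i₂⟩ ⟨j₁, j₂⟩ h
  simp only [Nat.div_self (Nat.pos_of_neZero q), one_mul, sub_zero, Prod.mk.injEq] at h
  have key : ∀ i j : Fin q, ((i : ℕ) : ZMod q) = ((j : ℕ) : ZMod q) → i = j := by
    intro i j hij
    have := congrArg ZMod.val hij
    rw [ZMod.val_natCast_of_lt i.2, ZMod.val_natCast_of_lt j.2] at this
    exact Fin.ext this
  rw [key _ _ h.1, key _ _ h.2]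

theorem sq_le_of_abs_sub_le {a b B : ℝ} (ha : 0 ≤ a) (hb : 0 ≤ b) (h : |a - b| ≤ B) :
    (a - b) ^ 2 ≤ B * (a + b) := by
  rw [← sq_abs, sq]
  refine mul_le_mul h ?_ (abs_nonneg _) ((abs_nonneg _).trans h)
  rw [abs_le]
  constructor <;> linarith

theorem sum_sq_muVal_sub_le
    (hWeil : ∀ m n : ℤ, ¬(m = 0 ∧ n = 0) →
      ‖kloostermanS q m n‖ ≤ (q.divisors.card : ℝ) *
        Real.sqrt ((Int.gcd (Int.gcd m n) (q : ℤ) : ℝ) * q))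
    {R : ℝ} (hR : 0 < R) (hR' : R < 1 / 2) (x : ℝ × ℝ) :
    ∑ b : ZMod q × ZMod q, (muVal q R (x + gridPoint b) - Real.pi * R ^ 2) ^ 2 ≤
      (48 * Real.pi * (q.divisors.card : ℝ) ^ 3 * q / (q.totient : ℝ) ^ 2 + 12 * Real.pi / q) *
        (∑ a, gridKR q R x a) + 12 * Real.pi * q * (Real.pi * R ^ 2) := by
  have hq : 0 < q := Nat.pos_of_neZero q
  have hqr : (0 : ℝ) < q := by exact_mod_cast hq
  have hφ : (0 : ℝ) < q.totient := by exact_mod_cast Nat.totient_pos.mpr hq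
  have hpi := Real.pi_pos
  set h := gridKR q R x with hh
  set T := ∑ a, h a with hT
  set w := Real.pi * R ^ 2 with hw
  have hw0 : 0 ≤ w := by positivity
  have hnn : ∀ a, 0 ≤ h a := fun a => KR_nonneg _ _ _
  have hT0 : 0 ≤ T := Finset.sum_nonneg fun a _ => hnn a
  set A := T / (q : ℝ) ^ 2 with hA
  have hA0 : 0 ≤ A := by positivity
  have hTA : T = (q : ℝ) ^ 2 * A := by rw [hA]; field_simp
  have hAw : |A - w| ≤ 6 * Real.pi / q := by
    have := abs_sum_gridKR_torsion_sub_le hR hR' x (dvd_refl q) 0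
    rw [← sum_gridKR_eq_sum_torsion, ← hh, ← hT, hTA, ← mul_sub, abs_mul,
      abs_of_pos (by positivity)] at this
    rw [le_div_iff₀ hqr]
    nlinarith
  have hcard : (Fintype.card (ZMod q × ZMod q) : ℝ) = (q : ℝ) ^ 2 := by
    simp [ZMod.card, sq]
  have hmean : ∑ a, (h a - A) = 0 := by
    rw [Finset.sum_sub_distrib, Finset.sum_const, Finset.card_univ, nsmul_eq_mul, hcard,
      ← hTA, sub_self]
  have hmain := sum_sq_hyperbola_translates_le hWeil (fun a => h a - A) hmean
  have htors : ∀ g ∈ q.divisors, ((g : ℝ) ^ 3)⁻¹ *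
        ∑ b : ZMod q × ZMod q, (∑ j : Fin g × Fin g,
          (h ((((q / g * j.1 : ℕ) : ZMod q), ((q / g * j.2 : ℕ) : ZMod q)) - b) - A)) ^ 2 ≤
        24 * Real.pi * T := by
    intro g hg
    have hgq := Nat.dvd_of_mem_divisors hg
    have hg0 : (0 : ℝ) < g := by exact_mod_cast Nat.pos_of_mem_divisors hg
    have hgle : (g : ℝ) ≤ q := by exact_mod_cast Nat.le_of_dvd hq hgq
    rw [inv_mul_le_iff₀ (by positivity)]
    have hterm : ∀ b : ZMod q × ZMod q, (∑ j : Fin g × Fin g,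
          (h ((((q / g * j.1 : ℕ) : ZMod q), ((q / g * j.2 : ℕ) : ZMod q)) - b) - A)) ^ 2 ≤
        12 * Real.pi * g * (∑ j : Fin g × Fin g,
          h ((((q / g * j.1 : ℕ) : ZMod q), ((q / g * j.2 : ℕ) : ZMod q)) - b) +
            (g : ℝ) ^ 2 * A) := by
      intro b
      rw [Finset.sum_sub_distrib, Finset.sum_const, Finset.card_univ, nsmul_eq_mul,
        Fintype.card_prod, Fintype.card_fin, Nat.cast_mul, ← sq]
      refine sq_le_of_abs_sub_le (Finset.sum_nonneg fun a _ => hnn _) (by positivity) ?_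
      refine (abs_sub_le _ ((g : ℝ) ^ 2 * w) _).trans ?_
      have h1 := abs_sum_gridKR_torsion_sub_le hR hR' x hgq b
      have h2 : |(g : ℝ) ^ 2 * w - (g : ℝ) ^ 2 * A| ≤ 6 * Real.pi * g := by
        rw [← mul_sub, abs_mul, abs_of_pos (by positivity), abs_sub_comm]
        calc (g : ℝ) ^ 2 * |A - w| ≤ (g : ℝ) ^ 2 * (6 * Real.pi / g) := by
              gcongr
              exact hAw.trans (by gcongr)
          _ = _ := by field_simp
      linarith
    have htot : ∑ b : ZMod q × ZMod q, ∑ j : Fin g × Fin g,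
        h ((((q / g * j.1 : ℕ) : ZMod q), ((q / g * j.2 : ℕ) : ZMod q)) - b) =
          (g : ℝ) ^ 2 * T := by
      rw [Finset.sum_comm]
      have : ∀ c : ZMod q × ZMod q, ∑ b, h (c - b) = T := fun c =>
        Fintype.sum_equiv (Equiv.subLeft c) _ _ fun _ => rfl
      simp_rw [this]
      simp [sq]
    calc _ ≤ ∑ b : ZMod q × ZMod q, 12 * Real.pi * g * (∑ j : Fin g × Fin g,
          h ((((q / g * j.1 : ℕ) : ZMod q), ((q / g * j.2 : ℕ) : ZMod q)) - b) +
            (g : ℝ) ^ 2 * A) := Finset.sum_le_sum fun b _ => hterm b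
      _ = 12 * Real.pi * g * ((g : ℝ) ^ 2 * T + (q : ℝ) ^ 2 * ((g : ℝ) ^ 2 * A)) := by
          rw [← Finset.mul_sum, Finset.sum_add_distrib, htot, Finset.sum_const, Finset.card_univ,
            nsmul_eq_mul, hcard]
      _ = _ := by rw [hTA]; ring
  have hV : (q.totient : ℝ) ^ 2 * ∑ b : ZMod q × ZMod q, (muVal q R (x + gridPoint b) - A) ^ 2 ≤
      24 * Real.pi * (q.divisors.card : ℝ) ^ 3 * q * T := by
    have hcount : (((Finset.range q).filter (fun d => Nat.Coprime d q)).card : ℝ) = q.totient := by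
      rw [Nat.totient_eq_card_coprime]
      simp_rw [Nat.coprime_comm]
    have heq : ∀ b : ZMod q × ZMod q,
        (q.totient : ℝ) ^ 2 * (muVal q R (x + gridPoint b) - A) ^ 2 =
        (∑ d ∈ (Finset.range q).filter (fun d => Nat.Coprime d q),
          (h (((d : ZMod q), (d : ZMod q)⁻¹) - b) - A)) ^ 2 := by
      intro b
      rw [Finset.sum_sub_distrib, Finset.sum_const, nsmul_eq_mul, hcount, muVal_add_gridPoint,
        ← mul_pow, mul_sub, ← mul_assoc, mul_one_div_cancel hφ.ne', one_mul]
    rw [Finset.mul_sum]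
    simp_rw [heq]
    refine hmain.trans ?_
    calc _ ≤ (q.divisors.card : ℝ) ^ 2 * q * ∑ g ∈ q.divisors, 24 * Real.pi * T := by
          exact mul_le_mul_of_nonneg_left (Finset.sum_le_sum htors)
            (mul_nonneg (sq_nonneg _) hqr.le)
      _ = _ := by
          rw [Finset.sum_const, nsmul_eq_mul]
          ring
  have hV' : ∑ b : ZMod q × ZMod q, (muVal q R (x + gridPoint b) - A) ^ 2 ≤
      24 * Real.pi * (q.divisors.card : ℝ) ^ 3 * q * T / (q.totient : ℝ) ^ 2 := by
    rw [le_div_iff₀ (by positivity), mul_comm]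
    exact hV
  have hAw2 := sq_le_of_abs_sub_le hA0 hw0 hAw
  calc _ ≤ ∑ b : ZMod q × ZMod q,
        (2 * (muVal q R (x + gridPoint b) - A) ^ 2 + 2 * (6 * Real.pi / q * (A + w))) := by
        refine Finset.sum_le_sum fun b _ => ?_
        nlinarith [sq_nonneg (muVal q R (x + gridPoint b) - A - (A - w))]
    _ = 2 * ∑ b : ZMod q × ZMod q, (muVal q R (x + gridPoint b) - A) ^ 2 +
        12 * Real.pi * q * (A + w) := by
        rw [Finset.sum_add_distrib, ← Finset.mul_sum, Finset.sum_const, Finset.card_univ,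
          nsmul_eq_mul, hcard]
        field_simp
        ring
    _ ≤ 2 * (24 * Real.pi * (q.divisors.card : ℝ) ^ 3 * q * T / (q.totient : ℝ) ^ 2) +
        12 * Real.pi * q * (A + w) := by gcongr
    _ = _ := by
        rw [hA]
        field_simp
        ring

theorem sq_mul_varMu_le
    (hWeil : ∀ m n : ℤ, ¬(m = 0 ∧ n = 0) →
      ‖kloostermanS q m n‖ ≤ (q.divisors.card : ℝ) *
        Real.sqrt ((Int.gcd (Int.gcd m n) (q : ℤ) : ℝ) * q))
    {R : ℝ} (hR : 0 < R) (hR' : R < 1 / 2) :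
    (q : ℝ) ^ 2 * varMu q R ≤
      (48 * Real.pi * (q.divisors.card : ℝ) ^ 3 * q / (q.totient : ℝ) ^ 2 + 12 * Real.pi / q) *
        ((q : ℝ) ^ 2 * (Real.pi * R ^ 2)) + 12 * Real.pi * q * (Real.pi * R ^ 2) := by
  have hfin : IsFiniteMeasure ((volume : Measure (ℝ × ℝ)).restrict
      (Set.Ioc (0 : ℝ) 1 ×ˢ Set.Ioc (0 : ℝ) 1)) :=
    ⟨by rw [Measure.restrict_apply_univ, volume_unitSquare]; exact ENNReal.one_lt_top⟩
  have hcard : (Fintype.card (ZMod q × ZMod q) : ℝ) = (q : ℝ) ^ 2 := by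
    simp [ZMod.card, sq]
  have hint : ∀ b : ZMod q × ZMod q, IntegrableOn
      (fun x => (muVal q R (x + gridPoint b) - Real.pi * R ^ 2) ^ 2)
      (Set.Ioc (0 : ℝ) 1 ×ˢ Set.Ioc (0 : ℝ) 1) := fun b =>
    ((memLp_muVal_add q hR.le _).sub (memLp_const _)).integrable_sq
  have hshift : (q : ℝ) ^ 2 * varMu q R = ∫ x in Set.Ioc (0 : ℝ) 1 ×ˢ Set.Ioc (0 : ℝ) 1,
      ∑ b : ZMod q × ZMod q, (muVal q R (x + gridPoint b) - Real.pi * R ^ 2) ^ 2 := by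
    rw [integral_finsetSum _ fun b _ => hint b]
    have : ∀ b : ZMod q × ZMod q, ∫ x in Set.Ioc (0 : ℝ) 1 ×ˢ Set.Ioc (0 : ℝ) 1,
        (muVal q R (x + gridPoint b) - Real.pi * R ^ 2) ^ 2 = varMu q R := fun b =>
      setIntegral_unitSquare_comp_add
        (f := fun x => (muVal q R x - Real.pi * R ^ 2) ^ 2)
        (fun m n x => by simp only [muVal_add_int]) (gridPoint b)
    simp_rw [this]
    rw [Finset.sum_const, Finset.card_univ, nsmul_eq_mul, hcard]
  have hgrid : ∀ a : ZMod q × ZMod q, IntegrableOn (fun x => gridKR q R x a)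
      (Set.Ioc (0 : ℝ) 1 ×ˢ Set.Ioc (0 : ℝ) 1) := fun a => integrableOn_KR hR.le _
  have hsum : IntegrableOn (fun x => ∑ a, gridKR q R x a)
      (Set.Ioc (0 : ℝ) 1 ×ˢ Set.Ioc (0 : ℝ) 1) := integrable_finsetSum _ fun a _ => hgrid a
  have htotal : ∫ x in Set.Ioc (0 : ℝ) 1 ×ˢ Set.Ioc (0 : ℝ) 1, ∑ a, gridKR q R x a =
      (q : ℝ) ^ 2 * (Real.pi * R ^ 2) := by
    rw [integral_finsetSum _ fun a _ => hgrid a]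
    simp only [gridKR, integral_KR hR.le]
    rw [Finset.sum_const, Finset.card_univ, nsmul_eq_mul, hcard]
  rw [hshift]
  refine (integral_mono (integrable_finsetSum _ fun b _ => hint b)
    ((hsum.const_mul _).add (integrable_const _))
    fun x => sum_sq_muVal_sub_le hWeil hR hR' x).trans_eq ?_
  rw [integral_add' (hsum.const_mul _) (integrable_const _), integral_const_mul, htotal,
    setIntegral_const]
  simp [Measure.real, volume_unitSquare]

theorem varMu_le_card_divisors_pow
    (hWeil : ∀ m n : ℤ, ¬(m = 0 ∧ n = 0) →
      ‖kloostermanS q m n‖ ≤ (q.divisors.card : ℝ) *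
        Real.sqrt ((Int.gcd (Int.gcd m n) (q : ℤ) : ℝ) * q))
    {R : ℝ} (hR : 0 < R) (hR' : R < 1 / 2) :
    varMu q R ≤ 72 * Real.pi * (Real.pi * R ^ 2 / q.totient) * (q.divisors.card : ℝ) ^ 4 := by
  have hq : 0 < q := Nat.pos_of_neZero q
  have hqr : (0 : ℝ) < q := by exact_mod_cast hq
  have hφ : (0 : ℝ) < q.totient := by exact_mod_cast Nat.totient_pos.mpr hq
  have hpi := Real.pi_pos
  have hτ : (1 : ℝ) ≤ q.divisors.card := by
    exact_mod_cast Finset.card_pos.mpr (Nat.nonempty_divisors.mpr hq.ne')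
  have hqφ : (q : ℝ) ≤ q.totient * q.divisors.card := by
    exact_mod_cast le_totient_mul_card_divisors q
  have hφq : (q.totient : ℝ) ≤ q := by exact_mod_cast Nat.totient_le q
  have h := sq_mul_varMu_le hWeil hR hR'
  set τ : ℝ := (q.divisors.card : ℝ)
  set φ : ℝ := (q.totient : ℝ)
  have h1 : varMu q R ≤ 48 * Real.pi * (Real.pi * R ^ 2) * (τ ^ 3 * q / φ ^ 2) +
      24 * Real.pi * (Real.pi * R ^ 2) * (1 / q) := by
    refine le_of_mul_le_mul_left (h.trans_eq ?_) (by positivity : (0 : ℝ) < (q : ℝ) ^ 2)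
    field_simp
    ring
  have h2 : τ ^ 3 * q / φ ^ 2 ≤ τ ^ 4 / φ := by
    rw [div_le_div_iff₀ (by positivity) hφ]
    calc τ ^ 3 * q * φ ≤ τ ^ 3 * (φ * τ) * φ := by gcongr
      _ = _ := by ring
  have h3 : 1 / (q : ℝ) ≤ τ ^ 4 / φ := by
    calc 1 / (q : ℝ) ≤ 1 / φ := by gcongr
      _ ≤ _ := by
        gcongr
        exact one_le_pow₀ hτ
  calc varMu q R ≤ 48 * Real.pi * (Real.pi * R ^ 2) * (τ ^ 4 / φ) +
      24 * Real.pi * (Real.pi * R ^ 2) * (τ ^ 4 / φ) := h1.trans (by gcongr)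
    _ = _ := by ring

end Grid

theorem variance_upper_bound
    (hWeil : ∀ q : ℕ, 0 < q → ∀ m n : ℤ, ¬(m = 0 ∧ n = 0) →
      ‖kloostermanS q m n‖ ≤ (q.divisors.card : ℝ) *
        Real.sqrt ((Int.gcd (Int.gcd m n) (q : ℤ) : ℝ) * q)) :
    ∀ ε : ℝ, 0 < ε → ∃ C : ℝ, 0 < C ∧ ∀ q : ℕ, 0 < q → ∀ R : ℝ, 0 < R → R < 1 / 2 →
      varMu q R ≤ C * (Real.pi * R ^ 2 / (q.totient : ℝ)) * (q : ℝ) ^ ε := by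
  intro ε hε
  obtain ⟨C, hC, hdiv⟩ := exists_card_divisors_le_rpow (show 0 < ε / 4 by positivity)
  have hpi := Real.pi_pos
  refine ⟨72 * Real.pi * C ^ 4, by positivity, fun q hq R hR hR' => ?_⟩
  have : NeZero q := ⟨hq.ne'⟩
  refine (varMu_le_card_divisors_pow (hWeil q hq) hR hR').trans ?_
  have hpow : (C * (q : ℝ) ^ (ε / 4)) ^ 4 = C ^ 4 * (q : ℝ) ^ ε := by
    rw [mul_pow, ← Real.rpow_natCast ((q : ℝ) ^ (ε / 4)), ← Real.rpow_mul (by positivity)]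
    congr 2
    push_cast
    ring
  calc _ ≤ 72 * Real.pi * (Real.pi * R ^ 2 / q.totient) * (C * (q : ℝ) ^ (ε / 4)) ^ 4 := by
        gcongr
        exact hdiv q hq
    _ = _ := by
        rw [hpow]
        ring
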